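/- arXiv:1511.08239 — 2 statements merged into one kernel-verified Lean document; each statement's English description precedes it below -/
import Mathlib

section
/- Let w ≈ w' be an identity satisfied by a monoid M, and suppose the Zimin word zₙ is an isoterm for M for some n ≥ 2. Then: (i) con(w) = con(w'); (ii) for every variable x, occ(x, w) = 1 if and only if occ(x, w') = 1; (iii) for all distinct variables x, y, one has w[x,y] = xyx if and only if w'[x,y] = xyx. -/
/-- Words over the countably infinite alphabet `A = ℕ`: elements of the free monoid `A*`. -/
abbrev Word : Type := FreeMonoid ℕ

/-- A monoid `M` satisfies the identity `u ≈ v` if every monoid homomorphism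
from the free monoid `A*` to `M` identifies `u` and `v`. -/
def Satisfies (M : Type*) [Monoid M] (u v : Word) : Prop :=
  ∀ f : Word →* M, f u = f v

/-- A word `w` is an isoterm for a monoid `M` if the only word `w'` with
`M ⊨ w ≈ w'` is `w' = w`. -/
def Isoterm (M : Type*) [Monoid M] (w : Word) : Prop :=
  ∀ w' : Word, Satisfies M w w' → w' = w

/-- The Zimin words over the variables `xᵢ = i`:
`z₁ = x₁` and `zₙ₊₁ = zₙ·xₙ₊₁·zₙ`. -/
def zimin : ℕ → Word
  | 0 => 1
  | 1 => FreeMonoid.of 1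
  | n + 2 => zimin (n + 1) * FreeMonoid.of (n + 2) * zimin (n + 1)

/-- The content of a word: the set of variables occurring in it. -/
def con (w : Word) : Set ℕ := {a | a ∈ FreeMonoid.toList w}

/-- The number of occurrences of the variable `x` in the word `w`. -/
def occ (x : ℕ) (w : Word) : ℕ := (FreeMonoid.toList w).count x

/-- The endomorphism of `A*` fixing the variables `x`, `y` and deleting all
other variables; `restrict2 x y w` is the word `w[x,y]`. -/
def restrict2 (x y : ℕ) : Word →* Word :=
  FreeMonoid.lift fun a => if a = x ∨ a = y then FreeMonoid.of a else 1

/-- The endomorphism sending `x` to `u`, `y` to `v` and every other variable to `1`. -/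
def substPair (x y : ℕ) (u v : Word) : Word →* Word :=
  FreeMonoid.lift fun a => if a = x then u else if a = y then v else 1

theorem Satisfies.symm {M : Type*} [Monoid M] {u v : Word} (h : Satisfies M u v) :
    Satisfies M v u :=
  fun f => (h f).symm

theorem Satisfies.map {M : Type*} [Monoid M] {u v : Word} (h : Satisfies M u v)
    (g : Word →* Word) : Satisfies M (g u) (g v) :=
  fun f => h (f.comp g)

theorem Satisfies.mul_left {M : Type*} [Monoid M] {u v : Word} (h : Satisfies M u v)
    (p : Word) : Satisfies M (p * u) (p * v) :=
  fun f => by rw [map_mul, map_mul, h f]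

theorem exists_zimin_succ_eq_of_mul (m : ℕ) :
    ∃ t, zimin (m + 1) = FreeMonoid.of 1 * t := by
  induction m with
  | zero => exact ⟨1, rfl⟩
  | succ m ih =>
    obtain ⟨t, ht⟩ := ih
    exact ⟨t * FreeMonoid.of (m + 2) * zimin (m + 1), by
      rw [zimin, ht]; simp only [mul_assoc]⟩

theorem length_zimin_pos {n : ℕ} (hn : n ≠ 0) : 0 < (zimin n).length := by
  obtain ⟨m, rfl⟩ := Nat.exists_eq_succ_of_ne_zero hn
  obtain ⟨t, ht⟩ := exists_zimin_succ_eq_of_mul m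
  rw [Nat.succ_eq_add_one, ht, FreeMonoid.length_mul, FreeMonoid.length_of]
  omega

theorem length_word_pow (u : Word) (k : ℕ) : (u ^ k).length = k * u.length := by
  induction k with
  | zero => simp
  | succ k ih => rw [pow_succ, FreeMonoid.length_mul, ih, Nat.succ_mul]

theorem occ_of_mul (x a : ℕ) (w : Word) :
    occ x (FreeMonoid.of a * w) = occ x w + if a = x then 1 else 0 := by
  simp [occ, List.count_cons]

theorem mem_con_iff_occ_ne_zero {x : ℕ} {w : Word} : x ∈ con w ↔ occ x w ≠ 0 := by
  simp [con, occ, List.count_eq_zero]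

theorem substPair_one_right (x : ℕ) (u w : Word) : substPair x x u 1 w = u ^ occ x w := by
  induction w using FreeMonoid.inductionOn' with
  | one => simp [occ]
  | of_mul a w ih =>
    rw [map_mul, ih, occ_of_mul]
    by_cases h : a = x <;> simp [substPair, h, pow_succ']

theorem substPair_restrict2 (x y : ℕ) (u v w : Word) :
    substPair x y u v (restrict2 x y w) = substPair x y u v w := by
  rw [← MonoidHom.comp_apply]
  congr 1
  ext a
  by_cases hx : a = x <;> by_cases hy : a = y <;> simp [substPair, restrict2, hx, hy]

theorem con_restrict2_subset (x y : ℕ) (w : Word) : con (restrict2 x y w) ⊆ {x, y} := by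
  induction w using FreeMonoid.inductionOn' with
  | one => simp [con]
  | of_mul b w ih =>
    intro a ha
    by_cases hb : b = x ∨ b = y
    · simp only [con, restrict2, map_mul, FreeMonoid.lift_eval_of, if_pos hb,
        FreeMonoid.toList_mul, FreeMonoid.toList_of, List.mem_append, List.mem_singleton,
        Set.mem_ofPred_eq] at ha
      rcases ha with rfl | ha
      · exact hb
      · exact ih ha
    · simp only [con, restrict2, map_mul, FreeMonoid.lift_eval_of, if_neg hb,
        one_mul, Set.mem_ofPred_eq] at ha
      exact ih ha

/-- Two nonempty words with distinct first letters, one of them a single letter, form a code. -/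
theorem substPair_injOn {x y b c : ℕ} (hxy : x ≠ y) (hbc : b ≠ c) (t : Word) :
    Set.InjOn (substPair x y (FreeMonoid.of b * t) (FreeMonoid.of c))
      {w | con w ⊆ {x, y}} := by
  set g := substPair x y (FreeMonoid.of b * t) (FreeMonoid.of c) with hg
  have gx : g (FreeMonoid.of x) = FreeMonoid.of b * t := by simp [hg, substPair]
  have gy : g (FreeMonoid.of y) = FreeMonoid.of c := by simp [hg, substPair, hxy.symm]
  have con_cons {a : ℕ} {w : Word} (h : con (FreeMonoid.of a * w) ⊆ {x, y}) :
      (a = x ∨ a = y) ∧ con w ⊆ {x, y} :=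
    ⟨h (by simp [con]), fun d hd => h (by
      simp only [con, Set.mem_ofPred_eq] at hd
      simp [con, hd])⟩
  have g_ne_one {a : ℕ} (ha : a = x ∨ a = y) (w : Word) :
      g (FreeMonoid.of a * w) ≠ 1 := by
    intro h
    have := congrArg FreeMonoid.length h
    rcases ha with rfl | rfl
    · simp [gx] at this
    · simp [gy] at this
  have heads_ne (p q : Word) : FreeMonoid.of b * p ≠ FreeMonoid.of c * q := fun h =>
    hbc (List.cons.inj (congrArg FreeMonoid.toList h)).1
  intro u
  induction u using FreeMonoid.inductionOn' with
  | one =>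
    intro _ v hv h
    cases v using FreeMonoid.casesOn with
    | one => rfl
    | of_mul a v =>
      rw [map_one] at h
      exact absurd h.symm (g_ne_one (con_cons hv).1 v)
  | of_mul a u ih =>
    intro hu v hv h
    obtain ⟨ha, hu⟩ := con_cons hu
    cases v using FreeMonoid.casesOn with
    | one => exact absurd (h.trans (map_one g)) (g_ne_one ha u)
    | of_mul d v =>
      obtain ⟨hd, hv⟩ := con_cons hv
      rcases ha with rfl | rfl <;> rcases hd with rfl | rfl
      · rw [map_mul, map_mul, mul_right_inj] at h
        rw [ih hu hv h]
      · rw [map_mul, map_mul, gx, gy, mul_assoc] at h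
        exact absurd h (heads_ne _ _)
      · rw [map_mul, map_mul, gx, gy, mul_assoc] at h
        exact absurd h.symm (heads_ne _ _)
      · rw [map_mul, map_mul, mul_right_inj] at h
        rw [ih hu hv h]

theorem Isoterm.con_subset {M : Type*} [Monoid M] {z w w' : Word} (hz : Isoterm M z)
    (h : Satisfies M w w') : con w ⊆ con w' := by
  intro x hx
  by_contra hx'
  rw [mem_con_iff_occ_ne_zero, not_not] at hx'
  have h₁ := (h.map (substPair x x (FreeMonoid.of x) 1)).symm.mul_left z
  rw [substPair_one_right, substPair_one_right, hx', pow_zero, mul_one] at h₁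
  have h₂ := congrArg FreeMonoid.length (hz _ h₁)
  rw [FreeMonoid.length_mul, length_word_pow, FreeMonoid.length_of] at h₂
  exact mem_con_iff_occ_ne_zero.1 hx (by omega)

theorem Isoterm.occ_eq_one {M : Type*} [Monoid M] {z w w' : Word} (hz : Isoterm M z)
    (hpos : 0 < z.length) (h : Satisfies M w w') {x : ℕ} (hx : occ x w = 1) :
    occ x w' = 1 := by
  have h₁ := h.map (substPair x x z 1)
  rw [substPair_one_right, substPair_one_right, hx, pow_one] at h₁
  have h₂ := congrArg FreeMonoid.length (hz _ h₁)
  rw [length_word_pow] at h₂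
  exact Nat.eq_of_mul_eq_mul_right hpos (by rw [h₂, one_mul])

theorem Isoterm.restrict2_eq {M : Type*} [Monoid M] {m : ℕ}
    (hz : Isoterm M (zimin (m + 2))) {w w' : Word} (h : Satisfies M w w') {x y : ℕ}
    (hxy : x ≠ y)
    (hw : restrict2 x y w = FreeMonoid.of x * FreeMonoid.of y * FreeMonoid.of x) :
    restrict2 x y w' = FreeMonoid.of x * FreeMonoid.of y * FreeMonoid.of x := by
  obtain ⟨t, ht⟩ := exists_zimin_succ_eq_of_mul m
  rw [← hw]
  refine substPair_injOn hxy (show 1 ≠ m + 2 by omega) t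
    (con_restrict2_subset x y w') (con_restrict2_subset x y w) ?_
  have hgw : substPair x y (FreeMonoid.of 1 * t) (FreeMonoid.of (m + 2)) w =
      zimin (m + 2) := by
    rw [← substPair_restrict2, hw, zimin, ht]
    simp [substPair, hxy.symm]
  rw [substPair_restrict2, substPair_restrict2, hgw]
  exact hz _ (hgw ▸ h.map _)

/-- If `M ⊨ w ≈ w'` and the Zimin word `zₙ` (some `n ≥ 2`) is an isoterm for `M`,
then `w` and `w'` have the same content, the same simple variables, and for distinct
variables `x, y`: `w[x,y] = xyx` iff `w'[x,y] = xyx`. -/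
theorem statement8 (M : Type*) [Monoid M] (n : ℕ) (hn : 2 ≤ n)
    (hz : Isoterm M (zimin n)) (w w' : Word) (h : Satisfies M w w') :
    con w = con w' ∧
    (∀ x : ℕ, occ x w = 1 ↔ occ x w' = 1) ∧
    (∀ x y : ℕ, x ≠ y →
      (restrict2 x y w = FreeMonoid.of x * FreeMonoid.of y * FreeMonoid.of x ↔
        restrict2 x y w' = FreeMonoid.of x * FreeMonoid.of y * FreeMonoid.of x)) := by
  obtain ⟨m, rfl⟩ := Nat.exists_eq_add_of_le' hn
  have hpos := length_zimin_pos (n := m + 2) (by omega)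
  exact ⟨(hz.con_subset h).antisymm (hz.con_subset h.symm),
    fun _ => ⟨hz.occ_eq_one hpos h, hz.occ_eq_one hpos h.symm⟩,
    fun _ _ hxy => ⟨hz.restrict2_eq h hxy, hz.restrict2_eq h.symm hxy⟩⟩
end

section
/- Let M be a monoid for which every Zimin word zₙ (n ≥ 1) is an isoterm. Then for every subset N of {3, 4, 5, …} and every k ≥ 3, the following are equivalent: (a) every monoid that satisfies all identities in Th(M) together with all identities ŵₙ ≈ ŵₙ' for n ∈ N also satisfies ŵ_k ≈ ŵ_k'; (b) k ∈ N. Consequently, the set of Birkhoff-closed sets of identities containing Th(M) has cardinality 2^ℵ₀; that is, the monoid variety generated by M has continuum many subvarieties. -/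
/-- The set of identities satisfied by the monoid `M`. -/
def Th (M : Type*) [Monoid M] : Set (Word × Word) :=
  {p | Satisfies M p.1 p.2}

/-- A set `E` of identities is Birkhoff-closed if every identity satisfied by
every monoid satisfying all identities of `E` already belongs to `E`. -/
def BirkhoffClosed (E : Set (Word × Word)) : Prop :=
  ∀ u v : Word,
    (∀ (M : Type) [Monoid M], (∀ p ∈ E, Satisfies M p.1 p.2) → Satisfies M u v) →
    (u, v) ∈ E

/-- The fixed pairwise distinct variables: `y = 0`, `z = 1`, `h = 2`, `t = 3`, `xᵢ = i + 4`. -/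
def xh (i : ℕ) : ℕ := i + 4

/-- `ŵₙ = x₀hx₁yzx₀ · x₂x₁ · x₃x₂ ⋯ xₙ₋₁xₙ₋₂ · xₙyzxₙ₋₁txₙ`. -/
def wh (n : ℕ) : Word :=
  FreeMonoid.ofList [xh 0, 2, xh 1, 0, 1, xh 0] *
    ((List.range (n - 2)).map (fun i => FreeMonoid.ofList [xh (i + 2), xh (i + 1)])).prod *
    FreeMonoid.ofList [xh n, 0, 1, xh (n - 1), 3, xh n]

/-- `ŵₙ' = x₀hx₁zyx₀ · x₂x₁ · x₃x₂ ⋯ xₙ₋₁xₙ₋₂ · xₙzyxₙ₋₁txₙ`. -/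
def wh' (n : ℕ) : Word :=
  FreeMonoid.ofList [xh 0, 2, xh 1, 1, 0, xh 0] *
    ((List.range (n - 2)).map (fun i => FreeMonoid.ofList [xh (i + 2), xh (i + 1)])).prod *
    FreeMonoid.ofList [xh n, 1, 0, xh (n - 1), 3, xh n]

/-! ### Injective encounters in Zimin words -/

/-- Insert the letter `0` around all letters of a word, after shifting these letters by one. -/
def pad (l : List ℕ) : List ℕ := 0 :: l.flatMap fun c => [c + 1, 0]

/-- The Zimin words over the variables `0, 1, 2, …`, as lists. -/
def ziminList : ℕ → List ℕ
  | 0 => []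
  | m + 1 => pad (ziminList m)

theorem pad_append (u v : List ℕ) :
    pad (u ++ v) = pad u ++ v.flatMap fun c => [c + 1, 0] := by
  simp [pad]

theorem ziminList_succ (m : ℕ) : ziminList (m + 1) = ziminList m ++ m :: ziminList m := by
  induction m with
  | zero => simp [ziminList, pad]
  | succ m ih =>
    conv_lhs => rw [ziminList, ih, pad_append]
    simp [ziminList, pad]

theorem toList_zimin (m : ℕ) :
    FreeMonoid.toList (zimin m) = (ziminList m).map (· + 1) := by
  induction m with
  | zero => simp [zimin, ziminList]
  | succ m ih =>
    rw [ziminList_succ]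
    cases m with
    | zero => simp [zimin, ziminList]
    | succ m => simp [zimin, ih, FreeMonoid.toList_mul]

/-- A word is injectively encountered in a Zimin word if its image under some injective
substitution is a factor of a Zimin word. -/
def InjEncountered (w : List ℕ) : Prop :=
  ∃ φ : ℕ → List ℕ, Function.Injective (List.flatMap φ) ∧ ∃ m, w.flatMap φ <:+: ziminList m

/-- The substitution `x ↦ φ x`, as an endomorphism of the free monoid. -/
def substHom (φ : ℕ → List ℕ) : Word →* Word :=
  FreeMonoid.lift fun a => FreeMonoid.ofList (φ a)

theorem toList_substHom (φ : ℕ → List ℕ) (u : Word) :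
    FreeMonoid.toList (substHom φ u) = (FreeMonoid.toList u).flatMap φ := by
  induction u using FreeMonoid.inductionOn' with
  | one => simp
  | of_mul x xs ih =>
    rw [map_mul, FreeMonoid.toList_mul, ih]
    simp [substHom]

theorem Satisfies.subst {M : Type*} [Monoid M] {u v : Word} (h : Satisfies M u v)
    (φ : Word →* Word) (p q : Word) : Satisfies M (p * φ u * q) (p * φ v * q) := fun f => by
  have := h (f.comp φ)
  simp only [MonoidHom.comp_apply] at this
  simp [this]

theorem InjEncountered.isoterm {w : Word} (hw : InjEncountered (FreeMonoid.toList w))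
    {M : Type*} [Monoid M] (hz : ∀ n : ℕ, 1 ≤ n → Isoterm M (zimin n)) : Isoterm M w := by
  obtain ⟨φ, hφ, m, hm⟩ := hw
  replace hm : (FreeMonoid.toList w).flatMap φ <:+: ziminList (m + 1) := by
    rw [ziminList_succ]
    exact hm.trans (List.prefix_append _ _).isInfix
  obtain ⟨p, q, hpq⟩ := hm
  intro u hu
  set ψ : Word →* Word := substHom fun a => (φ a).map (· + 1) with hψ
  have key : ∀ v : Word, FreeMonoid.toList (ψ v) =
      ((FreeMonoid.toList v).flatMap φ).map (· + 1) := by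
    intro v
    rw [hψ, toList_substHom, List.map_flatMap]
  have hzw : zimin (m + 1) =
      FreeMonoid.ofList (p.map (· + 1)) * ψ w * FreeMonoid.ofList (q.map (· + 1)) := by
    apply FreeMonoid.toList.injective
    simp [FreeMonoid.toList_mul, key, toList_zimin, ← hpq]
  have h1 := hu.subst ψ (FreeMonoid.ofList (p.map (· + 1))) (FreeMonoid.ofList (q.map (· + 1)))
  rw [← hzw] at h1
  have h2 := hz (m + 1) (by omega) _ h1
  rw [hzw] at h2
  have h3 : ψ u = ψ w := mul_left_cancel (mul_right_cancel h2)
  have h4 := congrArg FreeMonoid.toList h3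
  rw [key, key] at h4
  exact FreeMonoid.toList.injective (hφ (List.map_injective_iff.2 (add_left_injective 1) h4))

/-- The letter `0` if `b` is true, and the empty word otherwise. -/
def optZero (b : Bool) : List ℕ := if b then [0] else []

/-- Insert the letter `0` between consecutive letters of a word, after shifting these letters by
one. -/
def interleave : List ℕ → List ℕ
  | [] => []
  | c :: l => (c + 1) :: l.flatMap fun d => [0, d + 1]

theorem pad_eq_interleave {l : List ℕ} (hl : l ≠ []) : pad l = 0 :: (interleave l ++ [0]) := by
  obtain ⟨c, l, rfl⟩ := List.exists_cons_of_ne_nil hl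
  simp only [pad, interleave, List.flatMap_cons, List.cons_append, List.nil_append,
    List.cons.injEq, true_and]
  induction l with
  | nil => rfl
  | cons d l ih => simpa using ih

/-- Extend a substitution `φ` to the deleted letter `f`, the functions `α` and `β` deciding which
images start and end with the new letter `0`. -/
def extendSubst (f : ℕ) (α β : ℕ → Bool) (φ : ℕ → List ℕ) (x : ℕ) : List ℕ :=
  if x = f then [0] else optZero (α x) ++ interleave (φ x) ++ optZero (β x)

section Extend

variable {f : ℕ} {α β : ℕ → Bool} {φ : ℕ → List ℕ}

theorem pad_eq_extendSubst (hα : α f = true) (hβ : β f = true) (hφ : ∀ x, φ x ≠ []) (x : ℕ) :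
    optZero (!α x) ++ extendSubst f α β φ x ++ optZero (!β x) =
      pad (if x = f then [] else φ x) := by
  by_cases hx : x = f
  · subst hx
    simp [extendSubst, optZero, hα, hβ, pad]
  · rw [extendSubst, if_neg hx, if_neg hx, pad_eq_interleave (hφ x)]
    cases α x <;> cases β x <;> simp [optZero]

theorem extendSubst_prefix (hα : α f = true) (hβ : β f = true) (hφ : ∀ x, φ x ≠ []) (x : ℕ)
    (w : List ℕ) (hw : (x :: w).IsChain fun p q => β p = !α q) :
    optZero (!α x) ++ (x :: w).flatMap (extendSubst f α β φ) <+: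
      pad ((x :: w).flatMap fun x => if x = f then [] else φ x) := by
  induction w generalizing x with
  | nil =>
    simp only [List.flatMap_cons, List.flatMap_nil, List.append_nil]
    rw [← pad_eq_extendSubst hα hβ hφ x]
    exact List.prefix_append _ _
  | cons y w ih =>
    rw [List.isChain_cons_cons] at hw
    have h := ih y hw.2
    rw [List.flatMap_cons, List.flatMap_cons (x := x), pad_append,
      ← pad_eq_extendSubst hα hβ hφ x, hw.1]
    generalize (y :: w).flatMap (extendSubst f α β φ) = u at h
    rw [pad] at h
    cases hy : α y <;> simp [hy, optZero] at h ⊢ <;> simpa using h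

theorem length_extendSubst_pos (hφ : ∀ x, φ x ≠ []) (x : ℕ) : extendSubst f α β φ x ≠ [] := by
  by_cases hx : x = f
  · simp [extendSubst, hx]
  · obtain ⟨c, l, h⟩ := List.exists_cons_of_ne_nil (hφ x)
    simp [extendSubst, hx, h, interleave]

theorem filter_interleave (l : List ℕ) :
    ((interleave l).filter (· ≠ 0)).map (· - 1) = l := by
  cases l with
  | nil => rfl
  | cons c l =>
    simp only [interleave]
    induction l with
    | nil => rfl
    | cons d l ih => simp at ih ⊢; exact ih

theorem filter_extendSubst (u : List ℕ) :
    ((u.flatMap (extendSubst f α β φ)).filter (· ≠ 0)).map (· - 1) =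
      (u.filter (· ≠ f)).flatMap φ := by
  induction u with
  | nil => rfl
  | cons x u ih =>
    rw [List.flatMap_cons, List.filter_append, List.map_append, ih]
    by_cases hx : x = f
    · simp [hx, extendSubst]
    · have := filter_interleave (φ x)
      rw [List.filter_cons_of_pos (by simpa using hx), List.flatMap_cons, extendSubst, if_neg hx]
      congr 1
      cases α x <;> cases β x <;> simpa [optZero] using this

/-- The number of leading zeros of a word. -/
def leadingZeros (l : List ℕ) : ℕ := (l.takeWhile (· = 0)).length

theorem leadingZeros_extendSubst (hφ : ∀ x, φ x ≠ []) {x : ℕ} (hx : x ≠ f) (l : List ℕ) :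
    leadingZeros (extendSubst f α β φ x ++ l) = (α x).toNat := by
  obtain ⟨c, r, h⟩ := List.exists_cons_of_ne_nil (hφ x)
  cases hα : α x <;> simp [extendSubst, hx, h, interleave, leadingZeros, optZero, hα]

theorem leadingZeros_cons_extendSubst (l : List ℕ) :
    leadingZeros (extendSubst f α β φ f ++ l) = leadingZeros l + 1 := by
  simp [extendSubst, leadingZeros]

theorem le_leadingZeros (hφ : ∀ x, φ x ≠ []) {y : ℕ} (u r : List ℕ)
    (hu : u.filter (· ≠ f) = y :: r) :
    (α y).toNat ≤ leadingZeros (u.flatMap (extendSubst f α β φ)) := by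
  induction u with
  | nil => simp at hu
  | cons x u ih =>
    rw [List.flatMap_cons]
    by_cases hx : x = f
    · subst hx
      rw [leadingZeros_cons_extendSubst]
      have := ih (by simpa using hu)
      omega
    · rw [leadingZeros_extendSubst hφ hx]
      rw [List.filter_cons_of_pos (by simpa using hx)] at hu
      simp only [List.cons.injEq] at hu
      rw [hu.1]

theorem extendSubst_ne (hφ : ∀ x, φ x ≠ []) {y : ℕ} (hy : y ≠ f) (u v : List ℕ)
    (h : u.filter (· ≠ f) = y :: v) (l : List ℕ) :
    extendSubst f α β φ f ++ u.flatMap (extendSubst f α β φ) ≠ extendSubst f α β φ y ++ l := by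
  intro e
  have h1 := congrArg leadingZeros e
  rw [leadingZeros_cons_extendSubst, leadingZeros_extendSubst hφ hy] at h1
  have := le_leadingZeros (α := α) (β := β) hφ u v h
  omega

theorem extendSubst_injective_aux (hφ : ∀ x, φ x ≠ []) (u v : List ℕ)
    (h : u.filter (· ≠ f) = v.filter (· ≠ f))
    (e : u.flatMap (extendSubst f α β φ) = v.flatMap (extendSubst f α β φ)) : u = v := by
  induction u generalizing v with
  | nil =>
    cases v with
    | nil => rfl
    | cons y v => simp [length_extendSubst_pos hφ] at e
  | cons x u ih =>
    cases v with
    | nil => simp [length_extendSubst_pos hφ] at e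
    | cons y v =>
      rw [List.flatMap_cons, List.flatMap_cons] at e
      by_cases hxy : x = y
      · subst hxy
        have h' : u.filter (· ≠ f) = v.filter (· ≠ f) := by
          by_cases hx : x = f
          · simpa [hx] using h
          · rw [List.filter_cons_of_pos (by simpa using hx),
              List.filter_cons_of_pos (by simpa using hx)] at h
            exact (List.cons.inj h).2
        rw [ih v h' (List.append_cancel_left e)]
      · by_cases hx : x = f
        · subst hx
          have hy : y ≠ x := fun h => hxy h.symm
          rw [List.filter_cons_of_neg (by simp),
            List.filter_cons_of_pos (by simpa using hy)] at h
          exact absurd e (extendSubst_ne hφ hy _ _ h _)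
        · rw [List.filter_cons_of_pos (by simpa using hx)] at h
          by_cases hy : y = f
          · subst hy
            rw [List.filter_cons_of_neg (by simp)] at h
            exact absurd e.symm (extendSubst_ne hφ hx _ _ h.symm _)
          · rw [List.filter_cons_of_pos (by simpa using hy)] at h
            exact absurd (List.cons.inj h).1 hxy

end Extend

/-- Deleting a free letter `f` reflects injective encounters.  Freeness is witnessed by `α` and
`β`, which separate the occurrences of `f` on the right and on the left of adjacent pairs. -/
theorem InjEncountered.of_filter {w : List ℕ} (f : ℕ) (α β : ℕ → Bool) (hα : α f = true)
    (hβ : β f = true) (hw : w.IsChain fun p q => β p = !α q)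
    (h : InjEncountered (w.filter (· ≠ f))) : InjEncountered w := by
  obtain ⟨φ, hinj, m, hm⟩ := h
  have hφ : ∀ x, φ x ≠ [] := by
    intro x hx
    have : [x] = [] := hinj (by simp [hx])
    simp at this
  refine ⟨extendSubst f α β φ, fun u v e => ?_, m + 1, ?_⟩
  · refine extendSubst_injective_aux hφ u v (hinj ?_) e
    rw [← filter_extendSubst (α := α) (β := β), ← filter_extendSubst (α := α) (β := β), e]
  · cases w with
    | nil => simp
    | cons x w =>
      have h1 := extendSubst_prefix hα hβ hφ x w hw
      have h2 : ((x :: w).flatMap fun x => if x = f then [] else φ x) =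
          ((x :: w).filter (· ≠ f)).flatMap φ := by
        generalize x :: w = l
        induction l with
        | nil => rfl
        | cons y l ih => by_cases hy : y = f <;> simp [hy] at ih ⊢ <;> exact ih
      rw [h2] at h1
      obtain ⟨p, q, hpq⟩ := hm
      have h3 : pad (((x :: w).filter (· ≠ f)).flatMap φ) <:+: ziminList (m + 1) := by
        rw [ziminList, ← hpq]
        refine ⟨p.flatMap fun c => [0, c + 1], q.flatMap fun c => [c + 1, 0], ?_⟩
        rw [pad_append]
        congr 1
        clear hpq
        induction p with
        | nil => simp
        | cons c p ih => simp [pad] at ih ⊢; exact ih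
      exact ((List.suffix_append _ _).isInfix.trans h1.isInfix).trans h3

/-! ### The words `ŵₙ` are injectively encountered in Zimin words -/

/-- The word `x_{j+2}x_{j+1} · x_{j+3}x_{j+2} ⋯` with `d` blocks. -/
def zigzag (j d : ℕ) : List ℕ := (List.range' j d).flatMap fun i => [xh (i + 2), xh (i + 1)]

theorem zigzag_zero (j : ℕ) : zigzag j 0 = [] := rfl

theorem zigzag_succ (j d : ℕ) :
    zigzag j (d + 1) = xh (j + 2) :: xh (j + 1) :: zigzag (j + 1) d := by
  simp [zigzag, List.range'_succ]

theorem mem_zigzag {j d a : ℕ} (h : a ∈ zigzag j d) : xh j < a := by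
  simp only [zigzag, List.mem_flatMap, List.mem_range'_1, xh] at h
  obtain ⟨i, hi, h⟩ := h
  simp only [List.mem_cons, List.not_mem_nil, or_false] at h
  simp only [xh]
  omega

theorem isChain_zigzag {R : ℕ → ℕ → Prop} {a j d : ℕ} {t : List ℕ} (ha : R a (xh (j + 2)))
    (h : ∀ i, j ≤ i → i < j + d → R (xh (i + 2)) (xh (i + 1)) ∧ R (xh (i + 1)) (xh (i + 3)))
    (ht : (xh (j + d + 2) :: t).IsChain R) :
    (a :: (zigzag j d ++ xh (j + d + 2) :: t)).IsChain R := by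
  induction d generalizing a j with
  | zero => simpa [zigzag_zero, ha] using ht
  | succ d ih =>
    have e : j + 1 + d = j + (d + 1) := by omega
    have h0 := h j le_rfl (by omega)
    rw [zigzag_succ, List.cons_append, List.cons_append, List.isChain_cons_cons,
      List.isChain_cons_cons, ← e]
    refine ⟨ha, h0.1, ih h0.2 ?_ (by rwa [e])⟩
    intro i h1 h2
    exact h i (by omega) (by omega)

theorem prod_blocks (n : ℕ) :
    FreeMonoid.toList ((List.range n).map
      fun i => FreeMonoid.ofList [xh (i + 2), xh (i + 1)]).prod = zigzag 0 n := by
  rw [FreeMonoid.toList_prod, zigzag, List.range_eq_range', List.map_map]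
  rfl

theorem toList_wh (m : ℕ) : FreeMonoid.toList (wh (m + 3)) =
    [xh 0, 2, xh 1, 0, 1, xh 0] ++ (zigzag 0 (m + 1) ++
      [xh (m + 3), 0, 1, xh (m + 2), 3, xh (m + 3)]) := by
  rw [wh, FreeMonoid.toList_mul, FreeMonoid.toList_mul, prod_blocks, List.append_assoc]
  rfl

theorem injEncountered_nil : InjEncountered [] := by
  refine ⟨fun x => [x], ?_, 0, by simp⟩
  rw [show (List.flatMap fun x : ℕ => [x]) = id from funext fun l => by simp]
  exact Function.injective_id

open scoped Classical in
theorem InjEncountered.of_filter_eq {w w' : List ℕ} (h : InjEncountered w') (f : ℕ)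
    (α β : ℕ → Prop) (hf : (w.filter fun a => !decide (a = f)) = w') (hα : α f)
    (hβ : β f) (hw : w.IsChain fun p q => β p ↔ ¬α q) : InjEncountered w := by
  refine .of_filter f (fun q => decide (α q)) (fun p => decide (β p)) (by simpa using hα)
    (by simpa using hβ) (hw.imp fun p q hpq => ?_) ?_
  · by_cases h1 : β p <;> by_cases h2 : α q <;> simp_all
  · convert h using 1
    rw [← hf]
    congr 1
    ext a
    simp

theorem injEncountered_tail (j d : ℕ) :
    InjEncountered (xh (j + 1) ::
      (zigzag j d ++ xh (j + d + 2) :: [xh (j + d + 1), 3, xh (j + d + 2)])) := by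
  have step : ∀ j d w', InjEncountered w' →
      ((zigzag j d ++ xh (j + d + 2) :: [xh (j + d + 1), 3, xh (j + d + 2)]).filter
        fun a => !decide (a = xh (j + 1))) = w' →
      InjEncountered (xh (j + 1) ::
        (zigzag j d ++ xh (j + d + 2) :: [xh (j + d + 1), 3, xh (j + d + 2)])) := by
    intro j d w' h' hw'
    refine h'.of_filter_eq (xh (j + 1))
      (fun q => (q = 3 ∧ d % 3 = 1) ∨ (4 ≤ q ∧ q % 3 = (j + 5) % 3))
      (fun p => (p = 3 ∧ d % 3 ≠ 2) ∨ (4 ≤ p ∧ p % 3 ≠ j % 3))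
      (by simpa using hw') (by unfold xh; omega) (by unfold xh; omega) ?_
    refine isChain_zigzag ?_ (fun i h1 h2 => ?_)
      (.cons_cons ?_ <| .cons_cons ?_ <| .cons_cons ?_ <| .singleton _)
    all_goals unfold xh; omega
  induction d generalizing j with
  | zero =>
    refine step j 0 [xh (j + 2), 3, xh (j + 2)] ?_ (by simp [zigzag_zero, xh])
    refine .of_filter_eq (w' := [3]) ?_ (xh (j + 2)) (· ≠ 3) (· ≠ 3)
      (by simp [xh]) (by simp [xh]) (by simp [xh]) (by simp [xh])
    exact .of_filter_eq injEncountered_nil 3 (fun _ => True) (fun _ => True) (by simp) trivial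
      trivial (by simp)
  | succ d ih =>
    refine step j (d + 1) _ (ih (j + 1)) ?_
    have e : j + 1 + d = j + (d + 1) := by omega
    rw [zigzag_succ, List.cons_append, List.cons_append, List.filter_cons_of_pos (by simp [xh]),
      List.filter_cons_of_neg (by simp), e, List.filter_eq_self.2]
    intro a ha
    rw [List.mem_append] at ha
    rcases ha with ha | ha
    · have := mem_zigzag ha
      simpa using this.ne'
    · simp only [xh, List.mem_cons, List.not_mem_nil, or_false] at ha
      have : a ≠ xh (j + 1) := by unfold xh; omega
      simp [this]

theorem injEncountered_wh (m : ℕ) : InjEncountered (FreeMonoid.toList (wh (m + 3))) := by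
  rw [toList_wh, zigzag_succ]
  have hz : ∀ f ≤ 5, ∀ a ∈ zigzag 1 m, ¬a = f := by
    intro f hf a ha
    have := mem_zigzag ha
    simp only [xh] at this
    omega
  have hc : ∀ (R : ℕ → ℕ → Prop) (a : ℕ) (t : List ℕ), R a (xh 3) →
      (∀ i < m, R (xh (i + 3)) (xh (i + 2)) ∧ R (xh (i + 2)) (xh (i + 4))) →
      (xh (m + 3) :: t).IsChain R → (a :: (zigzag 1 m ++ xh (m + 3) :: t)).IsChain R := by
    intro R a t h1 h2 h3
    rw [show m + 3 = 1 + m + 2 by omega] at h3 ⊢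
    refine isChain_zigzag h1 (fun i hi hi' => ?_) h3
    obtain ⟨i, rfl⟩ := Nat.exists_eq_add_of_le' hi
    exact h2 i (by omega)
  have h5 := injEncountered_tail 1 m
  rw [show 1 + m + 2 = m + 3 by omega, show 1 + m + 1 = m + 2 by omega] at h5
  have h4 : InjEncountered (2 :: xh 2 ::
      (zigzag 1 m ++ [xh (m + 3), xh (m + 2), 3, xh (m + 3)])) := by
    refine h5.of_filter_eq 2 (· = 2) (fun _ => True) ?_ (by simp) (by simp) ?_
    · simpa [xh] using hz 2 (by omega)
    · refine .cons_cons ?_ <| hc _ _ _ ?_ (fun i hi => ?_) <|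
        .cons_cons ?_ <| .cons_cons ?_ <| .cons_cons ?_ <| .singleton _
      all_goals simp [xh]
  have h3 : InjEncountered (xh 0 :: 2 :: xh 0 :: xh 2 ::
      (zigzag 1 m ++ [xh (m + 3), xh (m + 2), 3, xh (m + 3)])) := by
    refine h4.of_filter_eq (xh 0) (· = xh 0) (· ≠ 2) ?_ (by simp) (by simp [xh]) ?_
    · simpa [xh] using hz 4 (by omega)
    · refine .cons_cons ?_ <| .cons_cons ?_ <| .cons_cons ?_ <| hc _ _ _ ?_ (fun i hi => ?_) <|
        .cons_cons ?_ <| .cons_cons ?_ <| .cons_cons ?_ <| .singleton _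
      all_goals simp [xh]
  have h2 : InjEncountered (xh 0 :: 2 :: 1 :: xh 0 :: xh 2 ::
      (zigzag 1 m ++ [xh (m + 3), 1, xh (m + 2), 3, xh (m + 3)])) := by
    refine h3.of_filter_eq 1 (· = 1) (fun p => p ≠ 2 ∧ p ≠ xh (m + 3)) ?_ (by simp)
      (by simp [xh]) ?_
    · simpa [xh] using hz 1 (by omega)
    · refine .cons_cons ?_ <| .cons_cons ?_ <| .cons_cons ?_ <| .cons_cons ?_ <|
        hc _ _ _ ?_ (fun i hi => ?_) <|
        .cons_cons ?_ <| .cons_cons ?_ <| .cons_cons ?_ <| .cons_cons ?_ <| .singleton _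
      all_goals unfold xh; omega
  have h1 : InjEncountered (xh 0 :: 2 :: xh 1 :: 1 :: xh 0 :: xh 2 :: xh 1 ::
      (zigzag 1 m ++ [xh (m + 3), 1, xh (m + 2), 3, xh (m + 3)])) := by
    refine h2.of_filter_eq (xh 1)
      (fun q => q = 2 ∨ (q = 3 ∧ m % 3 ≠ 2) ∨ (q = 4 ∧ m % 3 ≠ 1) ∨ (5 ≤ q ∧ q % 3 ≠ 1))
      (fun p => (p = 1 ∧ m % 3 = 1) ∨ (p = 3 ∧ m % 3 = 0) ∨ (4 ≤ p ∧ (p % 3 = 2 ∨ p = m + 7)))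
      ?_ (by simp [xh]) (by simp [xh]) ?_
    · simp [xh]
      exact fun a ha => decide_eq_false (hz 5 (by omega) a ha)
    · refine .cons_cons ?_ <| .cons_cons ?_ <| .cons_cons ?_ <| .cons_cons ?_ <|
        .cons_cons ?_ <| .cons_cons ?_ <| hc _ _ _ ?_ (fun i hi => ?_) <|
        .cons_cons ?_ <| .cons_cons ?_ <| .cons_cons ?_ <| .cons_cons ?_ <| .singleton _
      all_goals unfold xh; omega
  refine h1.of_filter_eq 0 (fun q => q ≠ 1) (fun p => p = 0) ?_ (by simp) (by simp) ?_
  · simpa [xh] using hz 0 (by omega)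
  · refine .cons_cons ?_ <| .cons_cons ?_ <| .cons_cons ?_ <| .cons_cons ?_ <| .cons_cons ?_ <|
      .cons_cons ?_ <| .cons_cons ?_ <| hc _ _ _ ?_ (fun i hi => ?_) <|
      .cons_cons ?_ <| .cons_cons ?_ <| .cons_cons ?_ <| .cons_cons ?_ <| .cons_cons ?_ <|
      .singleton _
    all_goals simp [xh]

/-! ### Applications of the identities `ŵₙ ≈ ŵₙ'` to the word `ŵₖ` -/

/-- The letter of `ŵₙ` at position `p`. -/
def whLetter (n p : ℕ) : ℕ :=
  if p = 0 then 4 else if p = 1 then 2 else if p = 2 then 5 else if p = 3 then 0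
  else if p = 4 then 1 else if p = 2 * n + 3 then 0 else if p = 2 * n + 4 then 1
  else if p = 2 * n + 5 then n + 3 else if p = 2 * n + 6 then 3 else if p = 2 * n + 7 then n + 4
  else if p % 2 = 1 then (p - 5) / 2 + 4 else (p - 2) / 2 + 4

theorem whLetter_cases {n p : ℕ} (hn : 3 ≤ n) (hp : p < 2 * n + 8) {v : ℕ}
    (hv : whLetter n p = v) :
    (p = 0 ∧ v = 4) ∨ (p = 1 ∧ v = 2) ∨ (p = 2 ∧ v = 5) ∨ (p = 3 ∧ v = 0) ∨ (p = 4 ∧ v = 1) ∨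
    (p = 2 * n + 3 ∧ v = 0) ∨ (p = 2 * n + 4 ∧ v = 1) ∨ (p = 2 * n + 5 ∧ v = n + 3) ∨
    (p = 2 * n + 6 ∧ v = 3) ∨ (p = 2 * n + 7 ∧ v = n + 4) ∨
    (5 ≤ p ∧ p ≤ 2 * n + 1 ∧ 2 * v = p + 3) ∨ (6 ≤ p ∧ p ≤ 2 * n + 2 ∧ 2 * v = p + 6) := by
  unfold whLetter at hv
  iterate 10
    split at hv
    · left
      omega
    right
  split at hv
  · left
    omega
  · right
    omega

theorem zigzag_eq_map (n m : ℕ) (h : m + 1 < n) :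
    zigzag 0 m = (List.range' 6 (2 * m)).map (whLetter n) := by
  induction m with
  | zero => rfl
  | succ m ih =>
    have h1 : whLetter n (6 + 2 * m) = xh (m + 2) := by
      have := whLetter_cases (n := n) (p := 6 + 2 * m) (by omega) (by omega) rfl
      unfold xh
      omega
    have h2 : whLetter n (6 + (2 * m + 1)) = xh (m + 1) := by
      have := whLetter_cases (n := n) (p := 6 + (2 * m + 1)) (by omega) (by omega) rfl
      unfold xh
      omega
    rw [zigzag, List.range'_concat, List.flatMap_append, ← zigzag, ih (by omega),
      show 2 * (m + 1) = 2 * m + 1 + 1 by omega, List.range'_concat, List.range'_concat]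
    simp [h1, h2]

theorem toList_wh_eq_map (m : ℕ) :
    FreeMonoid.toList (wh (m + 3)) = (List.range (2 * (m + 3) + 8)).map (whLetter (m + 3)) := by
  rw [toList_wh, zigzag_eq_map (m + 3) (m + 1) (by omega), List.range_eq_range',
    show 2 * (m + 3) + 8 = 6 + (2 * (m + 1) + 6) by omega, ← List.range'_append,
    ← List.range'_append, List.map_append, List.map_append]
  congr 1
  congr 1
  simp only [List.range'_succ, List.map_cons, List.range'_zero, List.map_nil, List.cons.injEq,
    and_true, xh]
  refine ⟨?_, ?_, ?_, ?_, ?_, ?_⟩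
  all_goals
    generalize hv : whLetter (m + 3) _ = v
    have := whLetter_cases (by omega) (by omega) hv
    omega

theorem exists_cover {b : ℕ → ℕ} {s t P : ℕ} (hst : s ≤ t) (hs : b s ≤ P) (ht : P < b t) :
    ∃ j, s ≤ j ∧ j < t ∧ b j ≤ P ∧ P < b (j + 1) := by
  induction t, hst using Nat.le_induction with
  | base => omega
  | succ t hst ih =>
    by_cases h : P < b t
    · obtain ⟨j, h1, h2, h3⟩ := ih h
      exact ⟨j, h1, by omega, h3⟩
    · exact ⟨t, hst, by omega, by omega, ht⟩

/-- The positions of the first and the second occurrence of a letter in `ŵₖ`. -/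
def Mates (k p q : ℕ) : Prop :=
  (p = 0 ∧ q = 5) ∨ (p = 2 ∧ q = 7) ∨ (p = 3 ∧ q = 2 * k + 3) ∨ (p = 4 ∧ q = 2 * k + 4) ∨
    (6 ≤ p ∧ p % 2 = 0 ∧ p + 4 ≤ 2 * k + 2 ∧ q = p + 3) ∨ (p = 2 * k ∧ q = 2 * k + 5) ∨
    (p = 2 * k + 2 ∧ q = 2 * k + 7)

theorem Mates.even_or {k p q : ℕ} (h : Mates k p q) : p % 2 = 0 ∨ p = 3 := by
  unfold Mates at h
  omega

theorem Mates.left_eq_zero {k p : ℕ} (hk : 3 ≤ k) (h : Mates k p 5) : p = 0 := by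
  unfold Mates at h
  omega

theorem Mates.left_eq_two {k p : ℕ} (hk : 3 ≤ k) (h : Mates k p 7) : p = 2 := by
  unfold Mates at h
  omega

theorem Mates.right_eq {k p q : ℕ} (h : Mates k p q) (hp : 6 ≤ p) (hpk : p < 2 * k) :
    q = p + 3 := by
  unfold Mates at h
  omega

theorem Mates.right_eq_of_eq {k q : ℕ} (hk : 3 ≤ k) (h : Mates k (2 * k) q) :
    q = 2 * k + 5 := by
  unfold Mates at h
  omega

theorem Mates.eq_of_succ {k p q : ℕ} (hk : 3 ≤ k) (h : Mates k p q)
    (h' : Mates k (p + 1) (q + 1)) : p = 3 ∧ q = 2 * k + 3 := by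
  unfold Mates at h h'
  omega

set_option maxHeartbeats 2000000 in
theorem mates_of_whLetter_eq {k p q : ℕ} (hk : 3 ≤ k) (hpq : p < q) (hq : q < 2 * k + 8)
    (h : whLetter k p = whLetter k q) :
    Mates k p q := by
  unfold Mates
  have h1 := whLetter_cases hk (by omega : p < 2 * k + 8) rfl
  have h2 := whLetter_cases hk hq rfl
  rw [h] at h1
  generalize whLetter k q = v at h1 h2
  clear h
  rcases h1 with h1 | h1 | h1 | h1 | h1 | h1 | h1 | h1 | h1 | h1 | h1 | h1 <;>
  rcases h2 with h2 | h2 | h2 | h2 | h2 | h2 | h2 | h2 | h2 | h2 | h2 | h2 <;>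
  omega

/-- `ŵₖ` has no factor of the form `φ(ŵₙ)` with `φ(y)` and `φ(z)` nonempty, for `n ≠ k`;
here `b j` is the position where the image of the `j`-th letter starts, and `ℓ` gives the lengths of
the images of letters. -/
theorem eq_of_positions {n k : ℕ} (hn : 3 ≤ n) (hk : 3 ≤ k) (b ℓ : ℕ → ℕ)
    (hb : ∀ j < 2 * n + 8, b (j + 1) = b j + ℓ (whLetter n j))
    (hend : b (2 * n + 8) ≤ 2 * k + 8)
    (hrep : ∀ i j, i < j → j < 2 * n + 8 → whLetter n i = whLetter n j →
      ∀ r < ℓ (whLetter n i), whLetter k (b i + r) = whLetter k (b j + r))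
    (hy : 1 ≤ ℓ 0) (hz : 1 ≤ ℓ 1) : n = k := by
  have hmono : ∀ i j, i ≤ j → j ≤ 2 * n + 8 → b i ≤ b j := by
    intro i j hij
    induction j, hij using Nat.le_induction with
    | base => simp
    | succ j hij ih =>
      intro hj
      have := ih (by omega)
      have := hb j (by omega)
      omega
  have hR := fun i j hij hj he r hr => mates_of_whLetter_eq (p := b i + r) (q := b j + r) hk
    (by
      have := hb i (by omega)
      have := hmono (i + 1) j hij (by omega)
      omega)
    (by
      have := hb j hj
      have := hmono (j + 1) (2 * n + 8) (by omega) le_rfl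
      rw [← he] at *
      omega) (hrep i j hij hj he r hr)
  have l0 : whLetter n 3 = 0 := by
    have := whLetter_cases (p := 3) hn (by omega) rfl
    omega
  have l1 : whLetter n 4 = 1 := by
    have := whLetter_cases (p := 4) hn (by omega) rfl
    omega
  have l0' : whLetter n (2 * n + 3) = 0 := by
    have := whLetter_cases (p := 2 * n + 3) hn (by omega) rfl
    omega
  have l1' : whLetter n (2 * n + 4) = 1 := by
    have := whLetter_cases (p := 2 * n + 4) hn (by omega) rfl
    omega
  have e1 : whLetter n 0 = whLetter n 5 := by
    have := whLetter_cases (p := 0) hn (by omega) rfl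
    have := whLetter_cases (p := 5) hn (by omega) rfl
    omega
  have e2 : whLetter n 2 = whLetter n 7 := by
    have := whLetter_cases (p := 2) hn (by omega) rfl
    have := whLetter_cases (p := 7) hn (by omega) rfl
    omega
  have e3 : ∀ i, 3 ≤ i → i + 1 ≤ n → whLetter n (2 * i) = whLetter n (2 * i + 3) := by
    intro i h1 h2
    have := whLetter_cases (p := 2 * i) hn (by omega) rfl
    have := whLetter_cases (p := 2 * i + 3) hn (by omega) rfl
    omega
  have e4 : whLetter n (2 * n) = whLetter n (2 * n + 5) := by
    have := whLetter_cases (p := 2 * n) hn (by omega) rfl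
    have := whLetter_cases (p := 2 * n + 5) hn (by omega) rfl
    omega
  have e5 : whLetter n (2 * n + 2) = whLetter n (2 * n + 7) := by
    have := whLetter_cases (p := 2 * n + 2) hn (by omega) rfl
    have := whLetter_cases (p := 2 * n + 7) hn (by omega) rfl
    omega
  have b4 : b 4 = b 3 + ℓ 0 := l0 ▸ hb 3 (by omega)
  have b5 : b 5 = b 4 + ℓ 1 := l1 ▸ hb 4 (by omega)
  have b4' : b (2 * n + 4) = b (2 * n + 3) + ℓ 0 := l0' ▸ hb (2 * n + 3) (by omega)
  have Ry := hR 3 (2 * n + 3) (by omega) (by omega) (by rw [l0, l0'])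
  have Rz := hR 4 (2 * n + 4) (by omega) (by omega) (by rw [l1, l1'])
  rw [l0] at Ry
  rw [l1] at Rz
  have hs : b 3 + ℓ 0 = 4 ∧ b (2 * n + 3) + ℓ 0 = 2 * k + 4 := by
    have h := (Ry (ℓ 0 - 1) (by omega)).eq_of_succ hk (by
      convert Rz 0 (by omega) using 1 <;> omega)
    omega
  have hℓ0 : ℓ 0 = 1 := by
    by_contra hne
    have := (Ry (ℓ 0 - 2) (by omega)).eq_of_succ hk (by
      convert Ry (ℓ 0 - 1) (by omega) using 1 <;> omega)
    omega
  have hℓ1 : ℓ 1 = 1 := by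
    by_contra hne
    have := (Rz 0 (by omega)).eq_of_succ hk (Rz 1 (by omega))
    omega
  clear Ry Rz
  have hle : ∀ i j, i < j → j < 2 * n + 8 → whLetter n i = whLetter n j → i ≤ 2 ∨ 5 ≤ i →
      ℓ (whLetter n i) ≤ 1 := by
    intro i j hij hj he hi
    by_contra! hlt
    have := (hR i j hij hj he 0 (by omega)).eq_of_succ hk (hR i j hij hj he 1 (by omega))
    have hi0 := hb i (by omega)
    have h1 : i ≤ 2 → b (i + 1) ≤ b 3 := fun h => hmono _ _ (by omega) (by omega)
    have h2 : 5 ≤ i → b 5 ≤ b i := fun h => hmono _ _ (by omega) (by omega)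
    omega
  have x0 := hle 0 5 (by omega) (by omega) e1 (by omega)
  have x1 := hle 2 7 (by omega) (by omega) e2 (by omega)
  have xi := fun i h1 h2 => hle (2 * i) (2 * i + 3) (by omega) (by omega) (e3 i h1 h2) (by omega)
  have xn' := hle (2 * n) (2 * n + 5) (by omega) (by omega) e4 (by omega)
  have xn := hle (2 * n + 2) (2 * n + 7) (by omega) (by omega) e5 (by omega)
  have R0 := hR 0 5 (by omega) (by omega) e1 0
  have R1 := hR 2 7 (by omega) (by omega) e2 0
  have Ri := fun i h1 h2 => hR (2 * i) (2 * i + 3) (by omega) (by omega) (e3 i h1 h2) 0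
  have Rn' := hR (2 * n) (2 * n + 5) (by omega) (by omega) e4 0
  have Rn := hR (2 * n + 2) (2 * n + 7) (by omega) (by omega) e5 0
  clear hR hrep
  -- target positions 5 and 7 can only be covered by the letters at the same positions of `ŵₙ`
  have key : ∀ j P, 5 ≤ j → j < 2 * n + 3 → b j = P → P < b (j + 1) → P = 5 ∨ P = 7 →
      (P = 5 ∧ j = 5) ∨ (P = 7 ∧ j = 7) := by
    intro j P h5 hj hP hPj h57
    have hj' := hb j (by omega)
    rcases Nat.even_or_odd' j with ⟨i, rfl | rfl⟩
    · exfalso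
      by_cases h1 : i + 1 ≤ n
      · have := (Ri i (by omega) h1 (by omega)).even_or
        omega
      · by_cases h2 : i = n
        · subst h2
          have := (Rn' (by omega)).even_or
          omega
        · obtain rfl : i = n + 1 := by omega
          have := (Rn (by rw [show 2 * n + 2 = 2 * (n + 1) by omega]; omega)).even_or
          rw [show 2 * n + 2 = 2 * (n + 1) by omega] at this
          omega
    · by_cases h1 : i = 2
      · subst h1
        change b 5 = P at hP
        exact .inl ⟨by omega, rfl⟩
      · by_cases h2 : i = 3
        · subst h2
          refine .inr ⟨?_, rfl⟩
          by_contra hP7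
          obtain rfl : P = 5 := by omega
          have hm := hmono 2 3 (by omega) (by omega)
          have h0 : 0 < ℓ (whLetter n 7) := by
            change b 7 = 5 at hP
            change b 8 = b 7 + ℓ (whLetter n 7) at hj'
            change 5 < b 8 at hPj
            omega
          rw [← e2] at h0
          have h := R1 h0
          rw [add_zero, add_zero, show b 7 = 5 from hP] at h
          have := h.left_eq_zero hk
          have : b 3 = b 2 + ℓ (whLetter n 2) := hb 2 (by omega)
          omega
        · exfalso
          have he := e3 (i - 1) (by omega) (by omega)
          have h := Ri (i - 1) (by omega) (by omega)
          rw [show 2 * (i - 1) + 3 = 2 * i + 1 by omega] at h he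
          have h := h (by rw [he]; omega)
          have := hmono 5 (2 * (i - 1)) (by omega) (by omega)
          rw [add_zero, add_zero, hP] at h
          rcases h57 with rfl | rfl
          · have := h.left_eq_zero hk
            omega
          · have := h.left_eq_two hk
            omega
  have b6 : b 6 = 6 := by
    obtain ⟨j, h1, h2, h3, h4⟩ := exists_cover (b := b) (s := 5) (t := 2 * n + 3) (P := 5)
      (by omega) (by omega) (by omega)
    have := hmono 5 j h1 (by omega)
    obtain ⟨-, rfl⟩ | ⟨h, -⟩ := key j 5 h1 h2 (by omega) h4 (by omega)
    · have : b 6 = b 5 + ℓ (whLetter n 5) := hb 5 (by omega)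
      change 5 < b 6 at h4
      rw [e1] at x0
      omega
    · omega
  have b78 : b 7 = 7 ∧ b 8 = 8 := by
    obtain ⟨j, h1, h2, h3, h4⟩ := exists_cover (b := b) (s := 6) (t := 2 * n + 3) (P := 7)
      (by omega) (by omega) (by omega)
    have hj : ℓ (whLetter n j) ≤ 1 := by
      rcases Nat.even_or_odd' j with ⟨i, rfl | rfl⟩
      · by_cases h1 : i + 1 ≤ n
        · exact xi i (by omega) h1
        · by_cases h2 : i = n
          · subst h2
            exact xn'
          · obtain rfl : i = n + 1 := by omega
            exact xn
      · by_cases h2 : i = 3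
        · subst h2
          exact e2 ▸ x1
        · have := xi (i - 1) (by omega) (by omega)
          rw [e3 (i - 1) (by omega) (by omega),
            show 2 * (i - 1) + 3 = 2 * i + 1 by omega] at this
          exact this
    have hbj := hb j (by omega)
    obtain ⟨h, -⟩ | ⟨-, rfl⟩ := key j 7 (by omega) h2 (by omega) h4 (by omega)
    · omega
    · change b 8 = b 7 + ℓ (whLetter n 7) at hbj
      change 7 < b 8 at h4
      have : b 6 ≤ b 7 := hmono 6 7 (by omega) (by omega)
      omega
  have ind : ∀ I, 2 ≤ I → I < n → I < k →
      b (2 * I + 2) = 2 * I + 2 ∧ b (2 * I + 3) = 2 * I + 3 ∧ b (2 * I + 4) = 2 * I + 4 := by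
    intro I hI
    induction I, hI using Nat.le_induction with
    | base => exact fun _ _ => ⟨b6, b78⟩
    | succ I hI ih =>
      intro h1 h2
      obtain ⟨i1, i2, i3⟩ := ih (by omega) (by omega)
      have h := Ri (I + 1) (by omega) (by omega)
      have c1 := hb (2 * (I + 1)) (by omega)
      have c2 := hb (2 * (I + 1) + 3) (by omega)
      have he := e3 (I + 1) (by omega) (by omega)
      rw [← he] at c2
      simp only [show 2 * (I + 1) = 2 * I + 2 by omega, add_assoc, Nat.reduceAdd] at *
      have := (h (by omega)).right_eq (by omega) (by omega)
      omega
  by_contra hne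
  rcases Nat.lt_or_gt_of_ne hne with hlt | hlt
  · obtain ⟨-, -, h⟩ := ind (n - 1) (by omega) (by omega) (by omega)
    rw [show 2 * (n - 1) + 4 = 2 * n + 2 by omega] at h
    have := hb (2 * n + 2) (by omega)
    simp only [add_assoc, Nat.reduceAdd] at this
    omega
  · obtain ⟨h1, h2, h3⟩ := ind (k - 1) (by omega) (by omega) (by omega)
    rw [show 2 * (k - 1) + 2 = 2 * k by omega] at h1
    rw [show 2 * (k - 1) + 3 = 2 * k + 1 by omega] at h2
    rw [show 2 * (k - 1) + 4 = 2 * (k + 1) by omega] at h3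
    have c1 := hb (2 * k) (by omega)
    have c2 := hb (2 * (k + 1)) (by omega)
    have h := Ri k (by omega) (by omega) (by omega)
    rw [add_zero, add_zero, h1] at h
    have := h.right_eq_of_eq hk
    have : ℓ (whLetter n (2 * (k + 1))) ≤ 1 := by
      by_cases h : k + 2 ≤ n
      · exact xi (k + 1) (by omega) h
      · obtain rfl : n = k + 1 := by omega
        exact xn'
    rw [show 2 * (k + 1) + 1 = 2 * k + 3 by omega] at c2
    omega

theorem getElem?_append_flatMap {p s q : List ℕ} {ψ : ℕ → List ℕ} {j a r : ℕ}
    (ha : s[j]? = some a) (hr : r < (ψ a).length) :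
    (p ++ s.flatMap ψ ++ q)[p.length + ((s.take j).flatMap ψ).length + r]? = (ψ a)[r]? := by
  obtain ⟨hj, rfl⟩ := List.getElem?_eq_some_iff.1 ha
  have hs : s.flatMap ψ = (s.take j).flatMap ψ ++ (ψ s[j] ++ (s.drop (j + 1)).flatMap ψ) := by
    rw [← List.flatMap_cons, ← List.drop_eq_getElem_cons hj, ← List.flatMap_append,
      List.take_append_drop]
  rw [hs, List.append_assoc, add_assoc, List.getElem?_append_right (by omega),
    Nat.add_sub_cancel_left, List.append_assoc, List.getElem?_append_right (by omega),
    Nat.add_sub_cancel_left, List.append_assoc, List.getElem?_append_left hr]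

theorem eq_of_flatMap_wh {n k : ℕ} (hn : 3 ≤ n) (hk : 3 ≤ k) {ψ : ℕ → List ℕ}
    (hy : ψ 0 ≠ []) (hz : ψ 1 ≠ []) {p q : List ℕ}
    (h : p ++ (FreeMonoid.toList (wh n)).flatMap ψ ++ q = FreeMonoid.toList (wh k)) : n = k := by
  have hw : ∀ n, 3 ≤ n →
      FreeMonoid.toList (wh n) = (List.range (2 * n + 8)).map (whLetter n) := by
    intro n hn
    obtain ⟨m, rfl⟩ := Nat.exists_eq_add_of_le' hn
    exact toList_wh_eq_map m
  rw [hw n hn, hw k hk] at h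
  set s := (List.range (2 * n + 8)).map (whLetter n) with hs
  have hget : ∀ j < 2 * n + 8, s[j]? = some (whLetter n j) := by
    intro j hj
    simp [hs, hj]
  have hstart : ∀ j < 2 * n + 8, ∀ r < (ψ (whLetter n j)).length,
      some (whLetter k (p.length + ((s.take j).flatMap ψ).length + r)) =
        (ψ (whLetter n j))[r]? := by
    intro j hj r hr
    have h1 := getElem?_append_flatMap (p := p) (q := q) (hget j hj) hr
    rw [h, List.getElem?_map] at h1
    rw [← h1]
    rw [List.getElem?_eq_getElem hr] at h1
    obtain ⟨x, hx, -⟩ := Option.map_eq_some_iff.1 h1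
    obtain ⟨hlt, rfl⟩ := List.getElem?_eq_some_iff.1 hx
    rw [hx, Option.map_some, List.getElem_range]
  refine eq_of_positions hn hk (fun j => p.length + ((s.take j).flatMap ψ).length)
    (fun a => (ψ a).length) ?_ ?_ ?_ ?_ ?_
  · intro j hj
    rw [List.take_add_one, hget j hj]
    simp [add_assoc]
  · have := congrArg List.length h
    simp only [List.length_append, List.length_map, List.length_range] at this
    rw [List.take_of_length_le (by simp [hs])]
    omega
  · intro i j hij hj he r hr
    have h1 := hstart i (by omega) r hr
    rw [he] at hr h1
    exact Option.some_injective _ (h1.trans (hstart j hj r hr).symm)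
  · exact List.length_pos_of_ne_nil hy
  · exact List.length_pos_of_ne_nil hz

/-- The endomorphism of the free monoid interchanging `y` and `z`. -/
def swapHom : Word →* Word :=
  FreeMonoid.map (Equiv.swap 0 1)

theorem swapHom_wh (n : ℕ) : swapHom (wh n) = wh' n := by
  have hx : ∀ i, Equiv.swap 0 1 (xh i) = xh i := fun i =>
    Equiv.swap_apply_of_ne_of_ne (by simp [xh]) (by simp [xh])
  have h2 : Equiv.swap 0 1 2 = 2 := Equiv.swap_apply_of_ne_of_ne (by simp) (by simp)
  have h3 : Equiv.swap 0 1 3 = 3 := Equiv.swap_apply_of_ne_of_ne (by simp) (by simp)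
  simp [swapHom, wh, wh', map_list_prod, Function.comp_def, hx, h2, h3]

theorem map_wh_eq_of_commute {N : Type*} [Monoid N] (f : Word →* N) (n : ℕ)
    (h : Commute (f (.of 0)) (f (.of 1))) : f (wh n) = f (wh' n) := by
  have hyz : ∀ l r : List ℕ, f (FreeMonoid.ofList (l ++ [0, 1] ++ r)) =
      f (FreeMonoid.ofList (l ++ [1, 0] ++ r)) := by
    intro l r
    have e : ∀ a b : ℕ, FreeMonoid.ofList [a, b] = FreeMonoid.of a * FreeMonoid.of b :=
      fun _ _ => rfl
    simp only [FreeMonoid.ofList_append, map_mul, e, h.eq]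
  simp only [wh, wh', map_mul]
  rw [show f (FreeMonoid.ofList [xh 0, 2, xh 1, 0, 1, xh 0]) = _ from hyz [xh 0, 2, xh 1] [xh 0],
    show f (FreeMonoid.ofList [xh n, 0, 1, xh (n - 1), 3, xh n]) = _ from
      hyz [xh n] [xh (n - 1), 3, xh n]]
  rfl

theorem commute_of_mul_map_wh_mul_eq {n k : ℕ} (hn : 3 ≤ n) (hk : 3 ≤ k) (hnk : n ≠ k)
    {φ : Word →* Word} {p q : Word} (h : p * φ (wh n) * q = wh k) :
    Commute (φ (.of 0)) (φ (.of 1)) := by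
  have hφ : φ = substHom fun a => FreeMonoid.toList (φ (.of a)) :=
    FreeMonoid.hom_eq fun a => by simp [substHom]
  by_contra hc
  refine hnk (eq_of_flatMap_wh hn hk (ψ := fun a => FreeMonoid.toList (φ (.of a)))
    (p := FreeMonoid.toList p) (q := FreeMonoid.toList q) ?_ ?_ ?_)
  · intro h0
    have h0 : φ (.of 0) = 1 := h0
    exact hc (h0 ▸ Commute.one_left _)
  · intro h1
    have h1 : φ (.of 1) = 1 := h1
    exact hc (h1 ▸ Commute.one_right _)
  · rw [← toList_substHom, ← hφ, ← FreeMonoid.toList_mul, ← FreeMonoid.toList_mul, h]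

theorem mul_map_wh_mul_eq_iff {n k : ℕ} (hn : 3 ≤ n) (hk : 3 ≤ k) (hnk : n ≠ k)
    (φ : Word →* Word) (p q : Word) :
    p * φ (wh n) * q = wh k ↔ p * φ (wh' n) * q = wh k := by
  by_cases hc : Commute (φ (.of 0)) (φ (.of 1))
  · rw [map_wh_eq_of_commute φ n hc]
  · refine iff_of_false (fun h => hc (commute_of_mul_map_wh_mul_eq hn hk hnk h)) fun h => ?_
    rw [← swapHom_wh, ← MonoidHom.comp_apply] at h
    exact hc (commute_of_mul_map_wh_mul_eq hn hk hnk h).symm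

theorem wh'_ne_wh (k : ℕ) : wh' k ≠ wh k := fun h => by
  have := congrArg (fun w => (FreeMonoid.toList w)[3]?) h
  simp [wh, wh', FreeMonoid.toList_mul] at this

/-! ### The syntactic monoid of a word -/

/-- The syntactic congruence of the language `{w}`. -/
def syntacticCon (w : Word) : Con Word where
  r u v := ∀ p q : Word, p * u * q = w ↔ p * v * q = w
  iseqv := ⟨fun _ _ _ => Iff.rfl, fun h p q => (h p q).symm,
    fun h h' p q => (h p q).trans (h' p q)⟩
  mul' {a b c d} h h' p q := by
    have h1 := h p (c * q)
    have h2 := h' (p * b) q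
    simp only [mul_assoc] at h1 h2 ⊢
    exact h1.trans h2

theorem satisfies_syntacticCon_iff {w u v : Word} :
    Satisfies (syntacticCon w).Quotient u v ↔
      ∀ (φ : Word →* Word) (p q : Word), p * φ u * q = w ↔ p * φ v * q = w := by
  constructor
  · intro h φ p q
    exact (Con.eq _).1 (h ((syntacticCon w).mk'.comp φ)) p q
  · intro h f
    obtain ⟨φ, rfl⟩ : ∃ φ : Word →* Word, (syntacticCon w).mk'.comp φ = f := by
      refine ⟨FreeMonoid.lift fun a => (f (.of a)).out, FreeMonoid.hom_eq fun a => ?_⟩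
      simp only [MonoidHom.comp_apply, FreeMonoid.lift_eval_of]
      exact Quotient.out_eq _
    exact (Con.eq _).2 (h φ)

theorem Isoterm.satisfies_syntacticCon {M : Type*} [Monoid M] {w u v : Word}
    (hw : Isoterm M w) (h : Satisfies M u v) : Satisfies (syntacticCon w).Quotient u v := by
  refine satisfies_syntacticCon_iff.2 fun φ p q => ⟨?_, ?_⟩
  · rintro rfl
    exact hw _ (h.subst φ p q)
  · rintro rfl
    exact hw _ fun f => (h.subst φ p q f).symm

theorem forall_satisfies_wh_iff (M : Type*) [Monoid M]
    (hz : ∀ n : ℕ, 1 ≤ n → Isoterm M (zimin n)) {N : Set ℕ} (hN : N ⊆ {n | 3 ≤ n}) {k : ℕ}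
    (hk : 3 ≤ k) :
    (∀ (M' : Type) [Monoid M'],
        (∀ u v : Word, Satisfies M u v → Satisfies M' u v) →
        (∀ n ∈ N, Satisfies M' (wh n) (wh' n)) →
        Satisfies M' (wh k) (wh' k)) ↔ k ∈ N := by
  refine ⟨fun h => ?_, fun h M' _ _ hM' => hM' k h⟩
  by_contra hkN
  have hiso : Isoterm M (wh k) := by
    obtain ⟨m, rfl⟩ := Nat.exists_eq_add_of_le' hk
    exact (injEncountered_wh m).isoterm hz
  have hsat := h (syntacticCon (wh k)).Quotient (fun u v => hiso.satisfies_syntacticCon)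
    fun n hn => satisfies_syntacticCon_iff.2
      (mul_map_wh_mul_eq_iff (hN hn) hk fun e => hkN (e ▸ hn))
  have := (satisfies_syntacticCon_iff.1 hsat (MonoidHom.id _) 1 1).1 (by simp)
  exact wh'_ne_wh k (by simpa using this)

/-- The Birkhoff closure of a set of identities. -/
def birkhoffClosure (E : Set (Word × Word)) : Set (Word × Word) :=
  {p | ∀ (M : Type) [Monoid M], (∀ e ∈ E, Satisfies M e.1 e.2) → Satisfies M p.1 p.2}

theorem subset_birkhoffClosure (E : Set (Word × Word)) : E ⊆ birkhoffClosure E :=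
  fun e he _ _ h => h e he

theorem birkhoffClosed_birkhoffClosure (E : Set (Word × Word)) :
    BirkhoffClosed (birkhoffClosure E) :=
  fun _ _ h M _ hM => h M fun _ he => he M hM

theorem mk_birkhoffClosed (M : Type*) [Monoid M]
    (hz : ∀ n : ℕ, 1 ≤ n → Isoterm M (zimin n)) :
    Cardinal.mk {E : Set (Word × Word) // BirkhoffClosed E ∧ Th M ⊆ E} =
      Cardinal.continuum := by
  apply le_antisymm
  · refine (Cardinal.mk_subtype_le _).trans ?_
    have : Countable Word := inferInstanceAs (Countable (List ℕ))
    rw [Cardinal.mk_set, ← Cardinal.two_power_aleph0]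
    exact Cardinal.power_le_power_left two_ne_zero Cardinal.mk_le_aleph0
  · let E : Set ℕ → Set (Word × Word) := fun S => Th M ∪ (fun n => (wh n, wh' n)) '' ((· + 3) '' S)
    have hE : ∀ (S : Set ℕ) (k : ℕ), (wh (k + 3), wh' (k + 3)) ∈ birkhoffClosure (E S) ↔ k ∈ S := by
      intro S k
      have hS : (· + 3) '' S ⊆ {n | 3 ≤ n} := by
        rintro _ ⟨n, -, rfl⟩
        exact Nat.le_add_left 3 n
      have h := forall_satisfies_wh_iff M hz hS (Nat.le_add_left 3 k)
      rw [(add_left_injective 3).mem_set_image] at h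
      rw [← h]
      refine forall₂_congr fun M' _ => ?_
      simp only [E, Set.mem_union, or_imp, forall_and, Set.forall_mem_image, and_imp, Prod.forall]
      rfl
    have hinj : Function.Injective fun S : Set ℕ =>
        (⟨birkhoffClosure (E S), birkhoffClosed_birkhoffClosure _,
          Set.subset_union_left.trans (subset_birkhoffClosure _)⟩ :
          {E : Set (Word × Word) // BirkhoffClosed E ∧ Th M ⊆ E}) := by
      intro S S' h
      ext k
      rw [← hE S, ← hE S', show birkhoffClosure (E S) = _ from congrArg Subtype.val h]
    simpa using Cardinal.mk_le_of_injective hinj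

/-- Let `M` be a monoid for which all Zimin words are isoterms.  Then for every
`N ⊆ {3, 4, …}` and `k ≥ 3`: `ŵ_k ≈ ŵ_k'` is a consequence of
`Th(M) ∪ {ŵₙ ≈ ŵₙ' | n ∈ N}` iff `k ∈ N`; consequently the monoid variety
generated by `M` has continuum many subvarieties. -/
theorem statement10 (M : Type*) [Monoid M]
    (hz : ∀ n : ℕ, 1 ≤ n → Isoterm M (zimin n)) :
    (∀ N : Set ℕ, N ⊆ {n | 3 ≤ n} → ∀ k : ℕ, 3 ≤ k →
      ((∀ (M' : Type) [Monoid M'],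
          (∀ u v : Word, Satisfies M u v → Satisfies M' u v) →
          (∀ n ∈ N, Satisfies M' (wh n) (wh' n)) →
          Satisfies M' (wh k) (wh' k)) ↔ k ∈ N)) ∧
    Cardinal.mk {E : Set (Word × Word) // BirkhoffClosed E ∧ Th M ⊆ E} =
      Cardinal.continuum := by
  exact ⟨fun N hN k hk => forall_satisfies_wh_iff M hz hN hk, mk_birkhoffClosed M hz⟩
end
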